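/- The expected cascade function f is monotone on the solution space H = V × D: for all configurations A ⊆ B ⊆ H, f(A) ≤ f(B). -/

import Mathlib

open Finset

/-- The set of nodes that are in `U` or reachable from some node of `U`
along a directed path of edges in `A`. -/
def reach {V : Type*} (A : Finset (V × V)) (U : Finset V) : Set V :=
  {v | ∃ u ∈ U, Relation.ReflTransGen (fun a b => (a, b) ∈ A) u v}

/-- Expected cascade `I(U)` of a seed set `U` under the independent cascade model
with edge set `E` and propagation probabilities `pe`. -/
noncomputable def expCascade {V : Type*} [DecidableEq V]
    (E : Finset (V × V)) (pe : V × V → ℝ) (U : Finset V) : ℝ :=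
  ∑ A ∈ E.powerset, (∏ e ∈ A, pe e) * (∏ e ∈ E \ A, (1 - pe e)) * (reach A U).ncard

/-- `d_S[v]`: the highest discount assigned to `v` under configuration `S`
(`0` if `v` is assigned no discount). -/
noncomputable def dS {V : Type*} [DecidableEq V] (S : Finset (V × ℝ)) (v : V) : ℝ :=
  (insert (0 : ℝ) ((S.filter (fun h => h.1 = v)).image Prod.snd)).max' (insert_nonempty _ _)

/-- `Pr(U; S)`: the probability that `U` is the seed set under configuration `S`. -/
noncomputable def seedProb {V : Type*} [Fintype V] [DecidableEq V]
    (p : V → ℝ → ℝ) (S : Finset (V × ℝ)) (U : Finset V) : ℝ :=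
  (∏ u ∈ U, p u (dS S u)) * ∏ v ∈ Uᶜ, (1 - p v (dS S v))

/-- `f(S)`: the expected cascade of a configuration `S`. -/
noncomputable def expCascadeConfig {V : Type*} [Fintype V] [DecidableEq V]
    (E : Finset (V × V)) (pe : V × V → ℝ) (p : V → ℝ → ℝ) (S : Finset (V × ℝ)) : ℝ :=
  ∑ U ∈ (Finset.univ : Finset V).powerset, seedProb p S U * expCascade E pe U

lemma aux_step {V : Type*} [DecidableEq V] (q : V → ℝ) (a : V) (T : Finset V) (ha : a ∉ T)
    (g : Finset V → ℝ) :
    ∑ U ∈ (insert a T).powerset, ((∏ u ∈ U, q u) * ∏ v ∈ insert a T \ U, (1 - q v)) * g U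
    = ∑ U ∈ T.powerset, ((∏ u ∈ U, q u) * ∏ v ∈ T \ U, (1 - q v)) *
        ((1 - q a) * g U + q a * g (insert a U)) := by
  rw [Finset.sum_powerset_insert ha, ← Finset.sum_add_distrib]
  refine Finset.sum_congr rfl fun U hU => ?_
  have hUT := Finset.mem_powerset.1 hU
  have haU : a ∉ U := fun h => ha (hUT h)
  have h1 : insert a T \ U = insert a (T \ U) := Finset.insert_sdiff_of_notMem _ haU
  have h2 : insert a T \ insert a U = T \ U := by
    ext x
    simp only [Finset.mem_sdiff, Finset.mem_insert]
    constructor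
    · tauto
    · rintro ⟨h, h'⟩
      refine ⟨Or.inr h, ?_⟩
      rintro (rfl | h'')
      · exact ha h
      · exact h' h''
  have h3 : a ∉ T \ U := fun h => ha (Finset.mem_sdiff.1 h).1
  rw [h1, h2, Finset.prod_insert h3, Finset.prod_insert haU]
  ring

lemma aux_mono {V : Type*} [DecidableEq V] (q r : V → ℝ) (hq0 : ∀ v, 0 ≤ q v)
    (hqr : ∀ v, q v ≤ r v) (hr1 : ∀ v, r v ≤ 1) (T : Finset V) :
    ∀ g : Finset V → ℝ, Monotone g →
    ∑ U ∈ T.powerset, ((∏ u ∈ U, q u) * ∏ v ∈ T \ U, (1 - q v)) * g U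
    ≤ ∑ U ∈ T.powerset, ((∏ u ∈ U, r u) * ∏ v ∈ T \ U, (1 - r v)) * g U := by
  induction T using Finset.induction_on with
  | empty => intro g _; simp
  | insert a T ha ih =>
    intro g hg
    rw [aux_step q a T ha, aux_step r a T ha]
    refine (ih (fun U => (1 - q a) * g U + q a * g (insert a U)) ?_).trans ?_
    · intro U W h
      have e1 := hg h
      have e2 := hg (Finset.insert_subset_insert a h)
      exact add_le_add (mul_le_mul_of_nonneg_left e1 (by linarith [hqr a, hr1 a]))
        (mul_le_mul_of_nonneg_left e2 (hq0 a))
    · refine Finset.sum_le_sum fun U _ => mul_le_mul_of_nonneg_left ?_ ?_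
      · have := hg (Finset.subset_insert a U)
        nlinarith [hqr a, mul_nonneg (sub_nonneg.2 (hqr a)) (sub_nonneg.2 this)]
      · exact mul_nonneg (Finset.prod_nonneg fun v _ => (hq0 v).trans (hqr v))
          (Finset.prod_nonneg fun v _ => sub_nonneg.2 (hr1 v))

lemma expCascade_mono {V : Type*} [Fintype V] [DecidableEq V]
    (E : Finset (V × V)) (pe : V × V → ℝ)
    (hpe : ∀ e ∈ E, 0 ≤ pe e ∧ pe e ≤ 1) : Monotone (expCascade E pe) := by
  intro U W h
  refine Finset.sum_le_sum fun A hA => mul_le_mul_of_nonneg_left ?_ ?_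
  · refine Nat.cast_le.2 (Set.ncard_le_ncard ?_ (Set.toFinite _))
    rintro v ⟨u, hu, hv⟩
    exact ⟨u, h hu, hv⟩
  · exact mul_nonneg
      (Finset.prod_nonneg fun e he => (hpe e (Finset.mem_powerset.1 hA he)).1)
      (Finset.prod_nonneg fun e he => sub_nonneg.2 (hpe e (Finset.mem_sdiff.1 he).1).2)

lemma dS_mem {V : Type*} [Fintype V] [DecidableEq V] (D : Finset ℝ) (S : Finset (V × ℝ))
    (hS : S ⊆ Finset.univ ×ˢ D) (v : V) : dS S v ∈ insert (0 : ℝ) D := by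
  have h := Finset.max'_mem
    (insert (0 : ℝ) ((S.filter (fun h => h.1 = v)).image Prod.snd)) (insert_nonempty _ _)
  refine Finset.insert_subset_insert 0 ?_ h
  intro d hd
  obtain ⟨x, hx, rfl⟩ := Finset.mem_image.1 hd
  exact (Finset.mem_product.1 (hS (Finset.mem_filter.1 hx).1)).2

lemma dS_mono {V : Type*} [DecidableEq V] (A B : Finset (V × ℝ)) (h : A ⊆ B) (v : V) :
    dS A v ≤ dS B v :=
  Finset.max'_subset _ (Finset.insert_subset_insert 0
    (Finset.image_subset_image (Finset.filter_subset_filter _ h)))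

/-- The expected cascade function `f` is monotone on the solution space `H = V × D`. -/
theorem expCascadeConfig_monotone
    {V : Type*} [Fintype V] [DecidableEq V]
    (E : Finset (V × V)) (pe : V × V → ℝ)
    (hpe : ∀ e ∈ E, 0 ≤ pe e ∧ pe e ≤ 1)
    (D : Finset ℝ) (hD : ∀ d ∈ D, 0 < d)
    (p : V → ℝ → ℝ)
    (hp0 : ∀ v, p v 0 = 0)
    (hp01 : ∀ v, ∀ d ∈ insert (0 : ℝ) D, 0 ≤ p v d ∧ p v d ≤ 1)
    (hpmono : ∀ v, ∀ d₁ ∈ insert (0 : ℝ) D, ∀ d₂ ∈ insert (0 : ℝ) D,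
      d₁ ≤ d₂ → p v d₁ ≤ p v d₂)
    (A B : Finset (V × ℝ)) (hAB : A ⊆ B) (hBH : B ⊆ Finset.univ ×ˢ D) :
    expCascadeConfig E pe p A ≤ expCascadeConfig E pe p B := by
  have hA := hAB.trans hBH
  have key := aux_mono (fun v => p v (dS A v)) (fun v => p v (dS B v))
    (fun v => (hp01 v _ (dS_mem D A hA v)).1)
    (fun v => hpmono v _ (dS_mem D A hA v) _ (dS_mem D B hBH v) (dS_mono A B hAB v))
    (fun v => (hp01 v _ (dS_mem D B hBH v)).2) Finset.univ _ (expCascade_mono E pe hpe)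
  simpa only [expCascadeConfig, seedProb, Finset.compl_eq_univ_sdiff] using key
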